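/- arXiv:1307.4861 — 3 statements merged into one kernel-verified Lean document; each statement's English description precedes it below -/
import Mathlib

section
/- Let r ≥ 1, let G be a group generated by a subset A, and suppose every element of G is a product of k palindromes over A. Let W = (ℤ^r → G) ⋊ ℤ^r, where ℤ^r acts on the group of all functions ℤ^r → G (under pointwise multiplication) by shifts: (v • f)(x) = f(x − v). For a ∈ A let δ_a : ℤ^r → G be the function equal to a at the origin and to the identity elsewhere, and for i = 1,…,r let t_i = (1, e_i) ∈ W, where the first coordinate is the constant-identity function and e_i is the i-th standard basis vector of ℤ^r. Let S = {(δ_a, 0) : a ∈ A} ∪ {t_1,…,t_r}. Then every element of the subgroup of W generated by S (a copy of the restricted wreath product G ≀ ℤ^r) is a product of 3r + k palindromes over S. -/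
/-- A palindromic word over `X`: a finite list of elements of `X ∪ X⁻¹`
that reads the same forwards and backwards. -/
def IsPalindromicWord {G : Type*} [Group G] (X : Set G) (w : List G) : Prop :=
  (∀ g ∈ w, g ∈ X ∨ g⁻¹ ∈ X) ∧ w.reverse = w

/-- `g` is a product (in order) of the evaluations of `n` palindromic words over `X`. -/
def IsProdOfPalindromes {G : Type*} [Group G] (X : Set G) (n : ℕ) (g : G) : Prop :=
  ∃ ws : List (List G), ws.length = n ∧ (∀ w ∈ ws, IsPalindromicWord X w) ∧
    (ws.map List.prod).prod = g

/-- The shift automorphism of the group of all functions `ℤ^r → G`: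
`(v • f) (x) = f (x - v)`. -/
def shiftAut (r : ℕ) (G : Type*) [Group G] (v : Fin r → ℤ) :
    ((Fin r → ℤ) → G) ≃* ((Fin r → ℤ) → G) where
  toFun f := fun x => f (x - v)
  invFun f := fun x => f (x + v)
  left_inv f := funext fun x => by simp
  right_inv f := funext fun x => by simp
  map_mul' f g := rfl

/-- `ℤ^r` acting on `ℤ^r → G` by shifts, as a homomorphism to the automorphism group. -/
def shiftHom (r : ℕ) (G : Type*) [Group G] :
    Multiplicative (Fin r → ℤ) →* MulAut ((Fin r → ℤ) → G) where
  toFun v := shiftAut r G v.toAdd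
  map_one' := by
    ext f x
    simp [shiftAut]
  map_mul' u v := by
    ext f x
    simp only [shiftAut, toAdd_mul, MulAut.mul_apply, MulEquiv.coe_mk, Equiv.coe_fn_mk]
    congr 1
    abel

/-- The (unrestricted) wreath-type product `(ℤ^r → G) ⋊ ℤ^r`. -/
abbrev WrZr (r : ℕ) (G : Type*) [Group G] :=
  ((Fin r → ℤ) → G) ⋊[shiftHom r G] Multiplicative (Fin r → ℤ)

/-- The function `ℤ^r → G` equal to `a` at the origin and to the identity elsewhere. -/
def delta {G : Type*} [Group G] (r : ℕ) (a : G) : (Fin r → ℤ) → G :=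
  fun x => if x = 0 then a else 1

section PalHelpers

/-- The word set: letters of `S`. -/
def genS {G : Type*} [Group G] (A : Set G) (r : ℕ) : Set (WrZr r G) :=
  ({w : WrZr r G | ∃ a ∈ A, w = ⟨delta r a, 1⟩} ∪
          {w : WrZr r G | ∃ i : Fin r, w = ⟨1, Multiplicative.ofAdd (Pi.single i 1)⟩})

/-- `p` and `q` are evaluations of a word and of its reverse. -/
def RevPair {G : Type*} [Group G] (X : Set G) (p q : G) : Prop :=
  ∃ w : List G, (∀ g ∈ w, g ∈ X ∨ g⁻¹ ∈ X) ∧ w.prod = p ∧ w.reverse.prod = q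

/-- `p` is the evaluation of a palindrome. -/
def PalElt {G : Type*} [Group G] (X : Set G) (p : G) : Prop :=
  ∃ w : List G, IsPalindromicWord X w ∧ w.prod = p

theorem RevPair.one {G : Type*} [Group G] (X : Set G) : RevPair X 1 1 :=
  ⟨[], by simp, by simp, by simp⟩

theorem RevPair.mul {G : Type*} [Group G] {X : Set G} {p q p' q' : G}
    (h : RevPair X p q) (h' : RevPair X p' q') : RevPair X (p * p') (q' * q) := by
  obtain ⟨w, hw, rfl, rfl⟩ := h
  obtain ⟨w', hw', rfl, rfl⟩ := h'
  refine ⟨w ++ w', ?_, by simp, by simp⟩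
  intro g hg
  rcases List.mem_append.1 hg with h | h
  · exact hw g h
  · exact hw' g h

theorem RevPair.of_mem {G : Type*} [Group G] {X : Set G} {p : G}
    (h : p ∈ X ∨ p⁻¹ ∈ X) : RevPair X p p :=
  ⟨[p], by simpa using h, by simp, by simp⟩

theorem RevPair.pow {G : Type*} [Group G] {X : Set G} {p : G}
    (h : RevPair X p p) (n : ℕ) : RevPair X (p ^ n) (p ^ n) := by
  induction n with
  | zero => simpa using RevPair.one X
  | succ n ih =>
    have := ih.mul h
    rwa [← pow_succ, ← pow_succ'] at this

theorem RevPair.zpow_of_mem {G : Type*} [Group G] {X : Set G} {p : G}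
    (h : p ∈ X) (n : ℤ) : RevPair X (p ^ n) (p ^ n) := by
  obtain ⟨m, rfl | rfl⟩ := n.eq_nat_or_neg
  · simpa using (RevPair.of_mem (Or.inl h)).pow m
  · have : RevPair X p⁻¹ p⁻¹ := RevPair.of_mem (Or.inr (by simpa using h))
    simpa using this.pow m

theorem PalElt.one {G : Type*} [Group G] (X : Set G) : PalElt X 1 :=
  ⟨[], ⟨by simp, by simp⟩, by simp⟩

theorem PalElt.of_mem {G : Type*} [Group G] {X : Set G} {p : G}
    (h : p ∈ X ∨ p⁻¹ ∈ X) : PalElt X p :=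
  ⟨[p], ⟨by simpa using h, by simp⟩, by simp⟩

theorem PalElt.conj {G : Type*} [Group G] {X : Set G} {p u u' : G}
    (h : RevPair X u u') (hp : PalElt X p) : PalElt X (u * p * u') := by
  obtain ⟨w, hw, rfl, rfl⟩ := h
  obtain ⟨z, ⟨hz, hz'⟩, rfl⟩ := hp
  refine ⟨w ++ z ++ w.reverse, ⟨?_, by simp [hz']⟩, by simp [mul_assoc]⟩
  intro g hg
  simp only [List.mem_append, List.mem_reverse] at hg
  rcases hg with (h | h) | h
  · exact hw g h
  · exact hz g h
  · exact hw g h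

theorem PalElt.zpow_of_mem {G : Type*} [Group G] {X : Set G} {p : G}
    (h : p ∈ X) (n : ℤ) : PalElt X (p ^ n) := by
  have key : ∀ (q : G) (_ : q ∈ X ∨ q⁻¹ ∈ X) (m : ℕ), PalElt X (q ^ m) := by
    intro q hq m
    refine ⟨List.replicate m q, ⟨?_, by simp⟩, by simp⟩
    intro g hg
    rw [List.eq_of_mem_replicate hg]
    exact hq
  obtain ⟨m, rfl | rfl⟩ := n.eq_nat_or_neg
  · simpa using key p (Or.inl h) m
  · simpa using key p⁻¹ (Or.inr (by simpa using h)) m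

theorem IsProdOfPalindromes.mul_pal {G : Type*} [Group G] {X : Set G} {n : ℕ} {g p : G}
    (h : IsProdOfPalindromes X n g) (hp : PalElt X p) :
    IsProdOfPalindromes X (n + 1) (g * p) := by
  obtain ⟨ws, hl, hw, rfl⟩ := h
  obtain ⟨z, hz, rfl⟩ := hp
  refine ⟨ws ++ [z], by simp [hl], ?_, by simp⟩
  intro w hw'
  rcases List.mem_append.1 hw' with h | h
  · exact hw w h
  · rw [List.mem_singleton.1 h]; exact hz

/-- The reversal of a map of words. -/
theorem RevPair.map {G H : Type*} [Group G] [Group H] {X : Set G} {Y : Set H} (φ : G →* H)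
    (hφ : ∀ x ∈ X, φ x ∈ Y) {p q : G} (h : RevPair X p q) : RevPair Y (φ p) (φ q) := by
  obtain ⟨w, hw, rfl, rfl⟩ := h
  refine ⟨w.map φ, ?_, by simp [map_list_prod], by simp [map_list_prod]⟩
  intro g hg
  obtain ⟨x, hx, rfl⟩ := List.mem_map.1 hg
  rcases hw x hx with h | h
  · exact Or.inl (hφ _ h)
  · right; rw [← map_inv]; exact hφ _ h

theorem IsProdOfPalindromes.map {G H : Type*} [Group G] [Group H] {X : Set G} {Y : Set H}
    (φ : G →* H) (hφ : ∀ x ∈ X, φ x ∈ Y) {n : ℕ} {p : G} (h : IsProdOfPalindromes X n p) :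
    IsProdOfPalindromes Y n (φ p) := by
  obtain ⟨ws, hl, hw, rfl⟩ := h
  refine ⟨ws.map (List.map φ), by simp [hl], ?_, ?_⟩
  · intro w hw'
    obtain ⟨z, hz, rfl⟩ := List.mem_map.1 hw'
    obtain ⟨h1, h2⟩ := hw z hz
    refine ⟨?_, by rw [← List.map_reverse, h2]⟩
    intro g hg
    obtain ⟨x, hx, rfl⟩ := List.mem_map.1 hg
    rcases h1 x hx with h | h
    · exact Or.inl (hφ _ h)
    · right; rw [← map_inv]; exact hφ _ h
  · rw [map_list_prod, List.map_map, List.map_map]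
    congr 1
    apply List.map_congr_left
    intro a _
    simp [map_list_prod]

/-- Shorthand constructor. -/
def mkW {r : ℕ} {G : Type*} [Group G] (f : (Fin r → ℤ) → G) (v : Fin r → ℤ) : WrZr r G :=
  ⟨f, Multiplicative.ofAdd v⟩

theorem mkW_mul {r : ℕ} {G : Type*} [Group G] (f g : (Fin r → ℤ) → G) (v w : Fin r → ℤ) :
    mkW f v * mkW g w = mkW (fun x => f x * g (x - v)) (v + w) := by
  rfl

theorem mkW_one {r : ℕ} {G : Type*} [Group G] : (mkW 1 0 : WrZr r G) = 1 := rfl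

/-- Translations. -/
def transHom (r : ℕ) (G : Type*) [Group G] : Multiplicative (Fin r → ℤ) →* WrZr r G :=
  SemidirectProduct.inr

theorem transHom_apply {r : ℕ} {G : Type*} [Group G] (v : Fin r → ℤ) :
    transHom r G (Multiplicative.ofAdd v) = mkW 1 v := rfl

theorem mkW_zpow {r : ℕ} {G : Type*} [Group G] (v : Fin r → ℤ) (n : ℤ) :
    (mkW 1 v : WrZr r G) ^ n = mkW 1 (n • v) := by
  rw [← transHom_apply, ← map_zpow, ← ofAdd_zsmul, transHom_apply]

/-- The lamp group at the origin. -/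
def deltaHom (r : ℕ) (G : Type*) [Group G] : G →* WrZr r G where
  toFun g := mkW (delta r g) 0
  map_one' := by
    rw [← mkW_one]; congr 1; funext x; simp [delta]
  map_mul' a b := by
    rw [mkW_mul]
    congr 1
    · funext x; simp only [delta, sub_zero]; split_ifs <;> simp

theorem mem_genS_t {G : Type*} [Group G] (A : Set G) {r : ℕ} (i : Fin r) :
    (mkW 1 (Pi.single i 1) : WrZr r G) ∈ genS A r := Or.inr ⟨i, rfl⟩

theorem mem_genS_delta {G : Type*} [Group G] (A : Set G) {r : ℕ} (a : G) (ha : a ∈ A) :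
    deltaHom r G a ∈ genS A r := Or.inl ⟨a, ha, rfl⟩

theorem exists_rho {G : Type*} [Group G] (A : Set G) (hgen : Subgroup.closure A = ⊤) :
    ∃ ρ : G → G, ρ 1 = 1 ∧ ∀ g, RevPair A g (ρ g) := by
  classical
  have h : ∀ g : G, ∃ q, RevPair A g q := by
    intro g
    have hg : g ∈ Subgroup.closure A := by rw [hgen]; trivial
    rw [← Subgroup.mem_toSubmonoid, Subgroup.closure_toSubmonoid] at hg
    obtain ⟨l, hl, rfl⟩ := Submonoid.exists_list_of_mem_closure hg
    exact ⟨_, l, fun y hy => by simpa using hl y hy, rfl, rfl⟩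
  choose ρ hρ using h
  refine ⟨fun g => if g = 1 then 1 else ρ g, by simp, ?_⟩
  intro g
  by_cases hg : g = 1
  · subst hg; simpa using RevPair.one A
  · simpa [hg] using hρ g

/-- Every translation is the evaluation of a word whose reverse gives the same translation. -/
theorem revPair_trans {G : Type*} [Group G] (A : Set G) {r : ℕ} (v : Fin r → ℤ) :
    RevPair (genS A r) (mkW 1 v) (mkW 1 v) := by
  have key : ∀ s : Finset (Fin r), RevPair (genS A r)
      (mkW 1 (∑ i ∈ s, v i • Pi.single i (1 : ℤ))) (mkW 1 (∑ i ∈ s, v i • Pi.single i (1 : ℤ))) := by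
    classical
    intro s
    induction s using Finset.induction_on with
    | empty => simpa [mkW_one] using RevPair.one _
    | insert i s hi ih =>
      rw [Finset.sum_insert hi]
      have h1 := RevPair.zpow_of_mem (mem_genS_t A i) (v i)
      rw [mkW_zpow] at h1
      have h2 := h1.mul ih
      rw [mkW_mul, mkW_mul, add_comm (∑ i ∈ s, v i • Pi.single i (1 : ℤ))] at h2
      have e : (fun x : Fin r → ℤ => (1 : (Fin r → ℤ) → G) x *
          (1 : (Fin r → ℤ) → G) (x - v i • Pi.single i (1 : ℤ))) = 1 := by
        funext x; simp
      have e' : (fun x : Fin r → ℤ => (1 : (Fin r → ℤ) → G) x *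
          (1 : (Fin r → ℤ) → G) (x - ∑ i ∈ s, v i • Pi.single i (1 : ℤ))) = 1 := by
        funext x; simp
      rwa [e, e'] at h2
  have := key Finset.univ
  have hv : (∑ i, v i • Pi.single i (1 : ℤ)) = v := by
    funext j
    simp [Finset.sum_apply, Pi.single_apply]
  rwa [hv] at this

theorem revPair_point {G : Type*} [Group G] (A : Set G) {r : ℕ} (y : Fin r → ℤ) {g q : G}
    (h : RevPair A g q) :
    RevPair (genS A r) (mkW (fun x => if x = y then g else 1) 0)
      (mkW (fun x => if x = -y then q else 1) 0) := by
  have h1 := ((revPair_trans A y).mul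
    (h.map (deltaHom r G) (mem_genS_delta A))).mul (revPair_trans A (-y))
  have e1 : ∀ (y : Fin r → ℤ) (g : G), mkW 1 y * deltaHom r G g * mkW 1 (-y) =
      mkW (fun x => if x = y then g else 1) 0 := by
    intro y g
    simp only [deltaHom, MonoidHom.coe_mk, OneHom.coe_mk, mkW_mul]
    congr 1
    · funext x; simp [delta, sub_eq_zero]
    · simp
  have e2 := e1 (-y) q
  rw [neg_neg] at e2
  rw [e1, ← mul_assoc, e2] at h1
  exact h1

theorem revPair_fun {G : Type*} [Group G] (A : Set G) {r : ℕ} (ρ : G → G) (h1 : ρ 1 = 1)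
    (hρ : ∀ g, RevPair A g (ρ g)) (s : Finset (Fin r → ℤ)) :
    ∀ f : (Fin r → ℤ) → G, (∀ x, x ∉ s → f x = 1) →
    RevPair (genS A r) (mkW f 0) (mkW (fun x => ρ (f (-x))) 0) := by
  classical
  induction s using Finset.induction_on with
  | empty =>
    intro f hf
    have : f = 1 := by funext x; simpa using hf x
    subst this
    have : (fun x : Fin r → ℤ => ρ ((1 : (Fin r → ℤ) → G) (-x))) = 1 := by
      funext x; simpa using h1
    rw [this, mkW_one]
    exact RevPair.one _
  | insert y s hy ih =>
    intro f hf
    have h2 := ih (fun x => if x = y then 1 else f x) (by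
      intro x hx
      by_cases hxy : x = y
      · simp [hxy]
      · simp only [hxy, if_false]
        exact hf x (by simp [hxy, hx]))
    have h3 := (revPair_point A y (hρ (f y))).mul h2
    rw [mkW_mul, mkW_mul] at h3
    convert h3 using 2
    · funext x
      by_cases hxy : x = y <;> simp [hxy]
    · simp
    · funext x
      by_cases hxy : x = -y
      · simp [hxy, h1]
      · have : -x ≠ y := fun h => hxy (by rw [← h, neg_neg])
        simp [hxy, this]
    · simp

/-- The recursion which solves the telescoping equations. -/
def telRec {G : Type*} [Group G] {r : ℕ} (ρ : G → G) (i : Fin r) (f : (Fin r → ℤ) → G) :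
    ℕ → (Fin r → ℤ) → G
  | 0 => fun _ => 1
  | m + 1 => fun x => f x *
      (ρ ((ρ (telRec ρ i f m (x - Pi.single i 1)))⁻¹ * f (Pi.single i 1 - x)))⁻¹

theorem telRec_one {G : Type*} [Group G] {r : ℕ} (ρ : G → G) (h1 : ρ 1 = 1) (i : Fin r)
    (f : (Fin r → ℤ) → G) (m : ℕ) : ∀ x : Fin r → ℤ,
    (∀ n : ℤ, f (x + n • Pi.single i 1) = 1 ∧ f (-x + n • Pi.single i 1) = 1) →
    telRec ρ i f m x = 1 := by
  induction m with
  | zero => intro x _; rfl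
  | succ m ih =>
    intro x hx
    have a1 : f x = 1 := by simpa using (hx 0).1
    have a2 : f (Pi.single i 1 - x) = 1 := by
      have := (hx 1).2
      rwa [one_smul, neg_add_eq_sub] at this
    have a3 := ih (x - Pi.single i 1) (by
      intro n
      have b1 := (hx (n - 1)).1
      have b2 := (hx (n + 1)).2
      constructor
      · rw [← b1]; congr 1; rw [sub_smul, one_smul]; abel
      · rw [← b2]; congr 1; rw [add_smul, one_smul]; abel)
    simp [telRec, a1, a2, a3, h1]

theorem telescope {G : Type*} [Group G] {r : ℕ} (ρ : G → G) (h1 : ρ 1 = 1) (i : Fin r)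
    (f : (Fin r → ℤ) → G) (N : ℤ) (hN : 0 ≤ N) (hf : ∀ x, (∃ j, N < |x j|) → f x = 1) :
    ∃ a : (Fin r → ℤ) → G,
      (∀ x, a x = f x * (ρ ((ρ (a (x - Pi.single i 1)))⁻¹ * f (Pi.single i 1 - x)))⁻¹) ∧
      (∀ x, (∀ n : ℤ, f (x + n • Pi.single i 1) = 1 ∧ f (-x + n • Pi.single i 1) = 1) →
        a x = 1) ∧
      (∀ x, x i < -N → a x = 1) := by
  refine ⟨fun x => telRec ρ i f (x i + N + 1).toNat x, ?_, ?_, ?_⟩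
  · intro x
    by_cases hx : x i < -N
    · have e1 : (x i + N + 1).toNat = 0 := by omega
      have e2 : ((x - Pi.single i 1 : Fin r → ℤ) i + N + 1).toNat = 0 := by simp; omega
      have a1 : f x = 1 := hf x ⟨i, by rw [abs_of_neg (by omega)]; omega⟩
      have a2 : f (Pi.single i 1 - x) = 1 :=
        hf _ ⟨i, by simp only [Pi.sub_apply, Pi.single_eq_same]; rw [abs_of_pos (by omega)]; omega⟩
      simp only [e1, e2]
      simp [telRec, a1, a2, h1]
    · have e1 : (x i + N + 1).toNat = ((x - Pi.single i 1 : Fin r → ℤ) i + N + 1).toNat + 1 := by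
        simp; omega
      simp only [e1]
      rfl
  · intro x hx
    exact telRec_one ρ h1 i f _ x hx
  · intro x hx
    have e1 : (x i + N + 1).toNat = 0 := by omega
    simp only [e1]
    rfl

theorem finite_box {G : Type*} [Group G] {r : ℕ} (f : (Fin r → ℤ) → G) (N : ℤ)
    (hf : ∀ x, (∃ j, N < |x j|) → f x = 1) : {x | f x ≠ 1}.Finite := by
  apply (Set.finite_Icc (fun _ : Fin r => -N) (fun _ => N)).subset
  intro x hx
  rw [Set.mem_Icc]
  by_contra h
  apply hx
  apply hf
  by_contra h'
  push Not at h'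
  exact h ⟨fun j => (abs_le.1 (h' j)).1, fun j => (abs_le.1 (h' j)).2⟩

theorem box_finite {G : Type*} [Group G] {r : ℕ} (f : (Fin r → ℤ) → G)
    (hf : {x | f x ≠ 1}.Finite) : ∃ N : ℤ, 0 ≤ N ∧ ∀ x, (∃ j, N < |x j|) → f x = 1 := by
  refine ⟨∑ x ∈ hf.toFinset, ∑ j, |x j|, by positivity, ?_⟩
  rintro x ⟨j, hj⟩
  by_contra hx
  have hx' : x ∈ hf.toFinset := by simpa using hx
  have b1 : |x j| ≤ ∑ j, |x j| :=
    Finset.single_le_sum (f := fun j => |x j|) (fun _ _ => abs_nonneg _) (Finset.mem_univ j)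
  have b2 : ∑ j, |x j| ≤ ∑ x ∈ hf.toFinset, ∑ j, |x j| :=
    Finset.single_le_sum (f := fun x : Fin r → ℤ => ∑ j, |x j|)
      (fun _ _ => by positivity) hx'
  omega

theorem decompose {G : Type*} [Group G] {r : ℕ} (ρ : G → G) (h1 : ρ 1 = 1) (i : Fin r)
    (f : (Fin r → ℤ) → G) (hfin : {x | f x ≠ 1}.Finite) (s : Finset (Fin r))
    (hs : ∀ x, f x ≠ 1 → ∀ j, j ∉ insert i s → x j = 0) :
    ∃ g u w : (Fin r → ℤ) → G, {x | g x ≠ 1}.Finite ∧ {x | u x ≠ 1}.Finite ∧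
      {x | w x ≠ 1}.Finite ∧ (∀ x, g x ≠ 1 → ∀ j, j ∉ s → x j = 0) ∧
      ∀ x, f x = g x * (u x * ρ (u (-x))) * (w x * ρ (w (Pi.single i 1 - x))) := by
  obtain ⟨N, hN, hf⟩ := box_finite f hfin
  obtain ⟨a, ha, ha1, haN⟩ := telescope ρ h1 i f N hN hf
  -- vanishing of `a` away from `i`
  have hv1 : ∀ x j, j ≠ i → N < |x j| → a x = 1 := by
    intro x j hj hx
    apply ha1
    intro n
    constructor <;> apply hf <;> refine ⟨j, ?_⟩ <;> simpa [hj] using hx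
  have hv2 : ∀ x j, j ∉ insert i s → x j ≠ 0 → a x = 1 := by
    intro x j hj hx
    have hji : j ≠ i := by rintro rfl; simp at hj
    apply ha1
    intro n
    constructor <;> by_contra hne <;> have := hs _ hne j hj <;> simp [hji] at this <;> exact hx this
  let w : (Fin r → ℤ) → G := fun x => if 0 < x i then (ρ (a (-x)))⁻¹ * f x else 1
  let u : (Fin r → ℤ) → G := fun x => if x i < 0 then a x else 1
  let g : (Fin r → ℤ) → G := fun x => if x i = 0 then f x * (ρ (w (Pi.single i 1 - x)))⁻¹ else 1
  have hu : ∀ x, (∃ j, N < |x j|) → u x = 1 := by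
    rintro x ⟨j, hj⟩
    simp only [u]
    split_ifs with hx
    · by_cases hji : j = i
      · subst hji
        apply haN
        rw [abs_of_neg hx] at hj; omega
      · exact hv1 x j hji hj
    · rfl
  have hw : ∀ x, (∃ j, N < |x j|) → w x = 1 := by
    rintro x ⟨j, hj⟩
    simp only [w]
    split_ifs with hx
    · have e : a (-x) = 1 := by
        by_cases hji : j = i
        · subst hji
          apply haN
          rw [abs_of_pos hx] at hj; simp; omega
        · exact hv1 (-x) j hji (by simpa using hj)
      rw [e, hf x ⟨j, hj⟩, h1]; simp
    · rfl
  have hg : ∀ x, (∃ j, N < |x j|) → g x = 1 := by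
    rintro x ⟨j, hj⟩
    simp only [g]
    split_ifs with hx
    · have hji : j ≠ i := by
        rintro rfl
        rw [hx, abs_zero] at hj; omega
      rw [hf x ⟨j, hj⟩, hw _ ⟨j, by simpa [hji] using hj⟩, h1]; simp
    · rfl
  refine ⟨g, u, w, finite_box g N hg, finite_box u N hu, finite_box w N hw, ?_, ?_⟩
  · intro x hx j hj
    by_cases hji : j = i
    · subst hji
      by_contra hne
      exact hx (by simp [g, hne])
    · by_contra hne
      have hj' : j ∉ insert i s := by simp [hji, hj]
      apply hx
      have e1 : f x = 1 := by
        by_contra h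
        exact hne (hs x h j hj')
      have e2 : f (Pi.single i 1 - x) = 1 := by
        by_contra h
        have := hs _ h j hj'
        simp [hji] at this
        exact hne this
      have e3 : a (-(Pi.single i 1 - x)) = 1 := hv2 _ j hj' (by simpa [hji] using hne)
      have e4 : w (Pi.single i 1 - x) = 1 := by
        simp only [w, e2, e3, h1]; simp
      simp only [g, e1, e4, h1]; simp
  · intro x
    rcases lt_trichotomy (x i) 0 with hx | hx | hx
    · have p1 : g x = 1 := by simp [g, hx.ne]
      have p2 : u x = a x := by simp [u, hx]
      have p3 : u (-x) = 1 := by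
        have : ¬ (-x) i < 0 := by simp; omega
        simp only [u, this, if_false]
      have p4 : w x = 1 := by
        have : ¬ 0 < x i := by omega
        simp only [w, this, if_false]
      have p5 : w (Pi.single i 1 - x) =
          (ρ (a (x - Pi.single i 1)))⁻¹ * f (Pi.single i 1 - x) := by
        have : 0 < (Pi.single i 1 - x : Fin r → ℤ) i := by simp; omega
        simp only [w, this, if_true, neg_sub]
      rw [p1, p2, p3, p4, p5, h1, ha x]; simp
    · have p2 : u x = 1 := by simp [u, hx]
      have p3 : u (-x) = 1 := by simp [u, hx]
      have p4 : w x = 1 := by simp [w, hx]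
      have p1 : g x = f x * (ρ (w (Pi.single i 1 - x)))⁻¹ := by simp only [g, hx, if_true]
      rw [p1, p2, p3, p4, h1]; simp
    · have p1 : g x = 1 := by simp [g, hx.ne']
      have p2 : u x = 1 := by
        have : ¬ x i < 0 := by omega
        simp only [u, this, if_false]
      have p3 : u (-x) = a (-x) := by simp [u, hx]
      have p4 : w x = (ρ (a (-x)))⁻¹ * f x := by simp [w, hx]
      have p5 : w (Pi.single i 1 - x) = 1 := by
        have : ¬ 0 < (Pi.single i 1 - x : Fin r → ℤ) i := by simp; omega
        simp only [w, this, if_false]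
      rw [p1, p2, p3, p4, p5, h1]; simp

theorem finite_shift {G : Type*} [Group G] {r : ℕ} (f : (Fin r → ℤ) → G)
    (hf : {x | f x ≠ 1}.Finite) (v : Fin r → ℤ) : {x | f (x - v) ≠ 1}.Finite :=
  hf.preimage (f := fun x => x - v) (sub_left_injective.injOn)

theorem main_induction {G : Type*} [Group G] (A : Set G) (r k : ℕ)
    (hgen : Subgroup.closure A = ⊤) (hA : ∀ g : G, IsProdOfPalindromes A k g)
    (s : Finset (Fin r)) : ∀ (f : (Fin r → ℤ) → G) (v : Fin r → ℤ), {x | f x ≠ 1}.Finite →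
    (∀ x, f x ≠ 1 → ∀ j, j ∉ s → x j = 0) → (∀ j, j ∉ s → v j = 0) →
    IsProdOfPalindromes (genS A r) (3 * s.card + k) (mkW f v) := by
  classical
  obtain ⟨ρ, h1, hρ⟩ := exists_rho A hgen
  induction s using Finset.induction_on with
  | empty =>
    intro f v _ hf hv
    have hv0 : v = 0 := by funext j; exact hv j (by simp)
    have hf0 : f = delta r (f 0) := by
      funext x
      simp only [delta]
      split_ifs with hx
      · rw [hx]
      · by_contra hne
        exact hx (by funext j; exact hf x hne j (by simp))
    have := (hA (f 0)).map (deltaHom r G) (mem_genS_delta A)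
    rw [hv0, hf0, Finset.card_empty, mul_zero, zero_add]
    exact this
  | insert i s hi ih =>
    intro f v hfin hf hv
    let v' : Fin r → ℤ := Function.update v i 0
    have hv' : ∀ j, j ∉ s → v' j = 0 := by
      intro j hj
      by_cases hji : j = i
      · simp [v', hji]
      · simp only [v', Function.update_of_ne hji]
        exact hv j (by simp [hji, hj])
    have hvv : v = v' + v i • Pi.single i 1 := by
      funext j
      by_cases hji : j = i
      · subst hji; simp [v']
      · simp [v', hji]
    obtain ⟨g, u, w, hg, hu, hw, hgs, hfac⟩ := decompose ρ h1 i (fun x => f (x - -v'))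
      (finite_shift f hfin (-v')) s (by
        intro x hx j hj
        have := hf _ hx j hj
        have h2 := hv' j (fun h => hj (Finset.mem_insert_of_mem h))
        simpa [h2] using this)
    have step := ih (fun x => g (x - v')) v' (finite_shift g hg v') (by
        intro x hx j hj
        have := hgs _ hx j hj
        simpa [hv' j hj] using this) hv'
    have ru := revPair_fun A ρ h1 hρ hu.toFinset u (by intro x hx; simpa using hx)
    have rw' := revPair_fun A ρ h1 hρ hw.toFinset w (by intro x hx; simpa using hx)
    have P1 := PalElt.conj ru (PalElt.one _)
    have P2 := PalElt.conj rw' (PalElt.of_mem (Or.inl (mem_genS_t A i)))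
    have P3 := PalElt.zpow_of_mem (mem_genS_t A i) (v i - 1)
    have tot := ((step.mul_pal P1).mul_pal P2).mul_pal P3
    rw [Finset.card_insert_of_notMem hi]
    have en : 3 * (s.card + 1) + k = 3 * s.card + k + 1 + 1 + 1 := by ring
    rw [en]
    convert tot using 1
    rw [mkW_zpow]
    rw [mul_one]
    simp only [mkW_mul]
    congr 1
    · funext x
      have := hfac (x - v')
      simp only [sub_neg_eq_add, sub_add_cancel] at this
      rw [this]
      simp [mul_assoc]
    · rw [hvv]
      simp only [sub_smul, one_smul, v']
      funext j
      by_cases hji : j = i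
      · subst hji; simp
      · simp [hji]

theorem finite_of_closure {G : Type*} [Group G] (A : Set G) (r : ℕ) (w : WrZr r G)
    (hw : w ∈ Subgroup.closure (genS A r)) : {x | w.left x ≠ 1}.Finite := by
  induction hw using Subgroup.closure_induction with
  | mem x hx =>
    rcases hx with ⟨a, _, rfl⟩ | ⟨i, rfl⟩
    · apply (Set.finite_singleton (0 : Fin r → ℤ)).subset
      intro x hx
      by_contra h
      apply hx
      have h' : x ≠ 0 := h
      simp [delta, h']
    · simp
  | one => simp
  | mul x y _ _ hx hy =>
    apply (hx.union (finite_shift _ hy x.right.toAdd)).subset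
    intro z hz
    by_contra h
    simp only [Set.mem_union, Set.mem_ofPred_eq, not_or, not_not] at h
    apply hz
    change x.left z * y.left (z - x.right.toAdd) = 1
    rw [h.1, h.2, one_mul]
  | inv x _ hx =>
    apply (finite_shift _ hx (-x.right.toAdd)).subset
    intro z hz h
    apply hz
    change (x.left (z - -x.right.toAdd))⁻¹ = 1
    rw [h, inv_one]

end PalHelpers

theorem pal_width_wreath_Zr {G : Type*} [Group G] (A : Set G) (r k : ℕ) (hr : 1 ≤ r)
    (hgen : Subgroup.closure A = ⊤)
    (hA : ∀ g : G, IsProdOfPalindromes A k g) :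
    ∀ w ∈ Subgroup.closure
        ({w : WrZr r G | ∃ a ∈ A, w = ⟨delta r a, 1⟩} ∪
          {w : WrZr r G | ∃ i : Fin r, w = ⟨1, Multiplicative.ofAdd (Pi.single i 1)⟩}),
      IsProdOfPalindromes
        ({w : WrZr r G | ∃ a ∈ A, w = ⟨delta r a, 1⟩} ∪
          {w : WrZr r G | ∃ i : Fin r, w = ⟨1, Multiplicative.ofAdd (Pi.single i 1)⟩})
        (3 * r + k) w := by
  intro w hw
  have h := main_induction A r k hgen hA Finset.univ w.left w.right.toAdd
    (finite_of_closure A r w hw) (by simp) (by simp)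
  rw [Finset.card_univ, Fintype.card_fin] at h
  exact h
end

section
/- Let r ≥ 1, let F be the free group on r generators x₁,…,x_r, let F'' be its second derived subgroup, and let M_r = F/F'' be the free metabelian group of rank r, generated by the images x̄₁,…,x̄_r of the free generators. Then every element of M_r is a product of 2^{r−1}·r·(r+1)·(2r+3) + 4r + 1 palindromes over {x̄₁,…,x̄_r}. -/
/-- The second derived subgroup `F''` of a group. -/
def secondDerived (F : Type*) [Group F] : Subgroup F :=
  ⁅commutator F, commutator F⁆

instance secondDerived_normal (F : Type*) [Group F] : (secondDerived F).Normal := by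
  unfold secondDerived; infer_instance

/-- The free metabelian group of rank `r`. -/
abbrev FreeMetabelian (r : ℕ) := FreeGroup (Fin r) ⧸ secondDerived (FreeGroup (Fin r))

namespace PalW

open scoped commutatorElement

variable {G : Type*} [Group G]

theorem prod_mul {X : Set G} {m n : ℕ} {g h : G} (hg : IsProdOfPalindromes X m g)
    (hh : IsProdOfPalindromes X n h) : IsProdOfPalindromes X (m + n) (g * h) := by
  obtain ⟨a, ha, ha', rfl⟩ := hg
  obtain ⟨b, hb, hb', rfl⟩ := hh
  refine ⟨a ++ b, by simp [ha, hb], ?_, by simp⟩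
  intro w hw
  rcases List.mem_append.1 hw with h | h
  · exact ha' w h
  · exact hb' w h

theorem prod_mono {X : Set G} {m n : ℕ} {g : G} (hg : IsProdOfPalindromes X m g)
    (hmn : m ≤ n) : IsProdOfPalindromes X n g := by
  obtain ⟨k, rfl⟩ := Nat.exists_eq_add_of_le hmn
  have : IsProdOfPalindromes X k (1 : G) := by
    refine ⟨List.replicate k [], by simp, ?_, by simp⟩
    intro w hw
    rw [List.eq_of_mem_replicate hw]
    simp [IsPalindromicWord]
  simpa using prod_mul hg this

theorem prod_ofFn {X : Set G} {m r : ℕ} {f : Fin r → G}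
    (hf : ∀ i, IsProdOfPalindromes X m (f i)) :
    IsProdOfPalindromes X (r * m) (List.ofFn f).prod := by
  induction r with
  | zero => exact ⟨[], by simp, by simp, by simp⟩
  | succ r ih =>
    rw [List.ofFn_succ, List.prod_cons, Nat.succ_mul, add_comm]
    exact prod_mul (hf 0) (ih fun i => hf _)

theorem pal_zpow {X : Set G} {x : G} (hx : x ∈ X) (k : ℤ) :
    IsProdOfPalindromes X 1 (x ^ k) := by
  rcases Int.eq_nat_or_neg k with ⟨n, rfl | rfl⟩
  · refine ⟨[List.replicate n x], by simp, ?_, by simp⟩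
    simp only [List.mem_singleton, forall_eq]
    refine ⟨fun g hg => ?_, by simp⟩
    rw [List.eq_of_mem_replicate hg]; exact Or.inl hx
  · refine ⟨[List.replicate n x⁻¹], by simp, ?_, by simp⟩
    simp only [List.mem_singleton, forall_eq]
    refine ⟨fun g hg => ?_, by simp⟩
    rw [List.eq_of_mem_replicate hg]; right; simpa using hx

theorem pal_comm {X : Set G} (hX : Subgroup.closure X = ⊤) {x : G} (hx : x ∈ X) (u : G) :
    IsProdOfPalindromes X 3 ⁅u, x⁆ := by
  have h2 : IsProdOfPalindromes X 2 (u * x * u⁻¹) := by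
    have hu : u ∈ Subgroup.closure X := by rw [hX]; trivial
    rw [← Subgroup.mem_toSubmonoid, Subgroup.closure_toSubmonoid] at hu
    obtain ⟨w, hw, rfl⟩ := Submonoid.exists_list_of_mem_closure hu
    simp only [Set.mem_union, Set.mem_inv] at hw
    have e1 : (w.map (·⁻¹)).reverse.prod = w.prod⁻¹ := (List.prod_inv_reverse w).symm
    have e2 : w.reverse.prod * (w.map (·⁻¹)).prod = 1 := by
      have := List.prod_inv_reverse w.reverse
      rw [← List.map_reverse, List.reverse_reverse] at this
      rw [← this]; simp
    refine ⟨[w ++ [x] ++ w.reverse, w.map (·⁻¹) ++ (w.map (·⁻¹)).reverse], by simp, ?_, ?_⟩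
    · intro v hv
      simp only [List.mem_cons, List.not_mem_nil, or_false] at hv
      rcases hv with rfl | rfl
      · refine ⟨fun g hg => ?_, by simp⟩
        simp only [List.mem_append, List.mem_reverse, List.mem_singleton] at hg
        rcases hg with (hg | rfl) | hg
        · exact hw g hg
        · exact Or.inl hx
        · exact hw g hg
      · refine ⟨fun g hg => ?_, by simp⟩
        simp only [List.mem_append, List.mem_reverse, or_self, List.mem_map] at hg
        obtain ⟨a, ha, rfl⟩ := hg
        rcases hw a ha with h | h
        · right; simpa using h
        · left; exact h
    · simp only [List.map_cons, List.map_nil, List.prod_cons, List.prod_nil, List.prod_append, e1,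
        mul_one]
      rw [mul_assoc, ← mul_assoc w.reverse.prod, e2, one_mul]
  have h1 := pal_zpow hx (-1)
  rw [zpow_neg_one] at h1
  rw [commutatorElement_def]
  exact prod_mul h2 h1

theorem abel_part {r : ℕ} (x : Fin r → G) (hx : Subgroup.closure (Set.range x) = ⊤) (g : G) :
    ∃ k : Fin r → ℤ, ∃ h ∈ commutator G, g = (List.ofFn fun i => x i ^ k i).prod * h := by
  let p : (Fin r → Multiplicative ℤ) →* Abelianization G :=
    ∏ i, (zpowersHom _ (Abelianization.of (x i))).comp (Pi.evalMonoidHom _ i)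
  have hp : ∀ k, p k = ∏ i, Abelianization.of (x i) ^ (k i).toAdd := by
    intro k; simp [p, MonoidHom.finsetProd_apply]
  have key : (⊤ : Subgroup G) ≤ p.range.comap Abelianization.of := by
    rw [← hx, Subgroup.closure_le]
    rintro _ ⟨i, rfl⟩
    refine ⟨Pi.mulSingle i (Multiplicative.ofAdd 1), ?_⟩
    rw [hp, Finset.prod_eq_single i]
    · simp
    · intro j _ hj; simp [Pi.mulSingle_eq_of_ne hj]
    · simp
  obtain ⟨k, hk⟩ := key (Subgroup.mem_top g)
  refine ⟨fun i => (k i).toAdd, (List.ofFn fun i => x i ^ (k i).toAdd).prod⁻¹ * g, ?_, by simp⟩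
  rw [← Abelianization.ker_of, MonoidHom.mem_ker, map_mul, map_inv, ← hk, hp, map_list_prod,
    List.map_ofFn, List.prod_ofFn]
  simp

/-- class two part -/
theorem class_two {Q : Type*} [Group Q] {r : ℕ} (y : Fin r → Q)
    (hy : Subgroup.closure (Set.range y) = ⊤)
    (hc : ∀ a b : Q, ⁅a, b⁆ ∈ Subgroup.center Q) (q : Q) (hq : q ∈ commutator Q) :
    ∃ u : Fin r → Q, q = (List.ofFn fun i => ⁅u i, y i⁆).prod := by
  have cc : ∀ a b c : Q, c * ⁅a, b⁆ = ⁅a, b⁆ * c := fun a b c =>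
    Subgroup.mem_center_iff.1 (hc a b) c
  have m1 : ∀ a b c : Q, ⁅a * b, c⁆ = ⁅a, c⁆ * ⁅b, c⁆ := by
    intro a b c
    have : ⁅a * b, c⁆ = a * ⁅b, c⁆ * a⁻¹ * ⁅a, c⁆ := by
      simp only [commutatorElement_def]; group
    rw [this, cc b c a, mul_inv_cancel_right, cc]
  have m2 : ∀ a b c : Q, ⁅a, b * c⁆ = ⁅a, b⁆ * ⁅a, c⁆ := by
    intro a b c
    rw [← commutatorElement_inv, m1, mul_inv_rev, commutatorElement_inv, commutatorElement_inv, cc]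
  let _ : CommGroup (Subgroup.center Q) :=
    { (inferInstance : Group (Subgroup.center Q)) with
      mul_comm := fun a b => Subtype.ext (Subgroup.mem_center_iff.1 b.2 a) }
  let f : Fin r → Q →* Subgroup.center Q := fun i =>
    MonoidHom.mk' (fun u => ⟨⁅u, y i⁆, hc _ _⟩) (fun a b => Subtype.ext (m1 a b _))
  let p : (Fin r → Q) →* Subgroup.center Q := ∏ i, (f i).comp (Pi.evalMonoidHom _ i)
  have hp : ∀ u, p u = ∏ i, f i (u i) := by
    intro k; simp [p, MonoidHom.finsetProd_apply]
  let R : Subgroup Q := p.range.map (Subgroup.center Q).subtype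
  let V : Subgroup Q :=
    { carrier := {v | ∀ u, ⁅u, v⁆ ∈ R}
      one_mem' := fun u => by simp
      mul_mem' := fun {a b} ha hb u => by rw [m2]; exact R.mul_mem (ha u) (hb u)
      inv_mem' := fun {a} ha u => by
        have : ⁅u, a⁻¹⁆ = ⁅u, a⁆⁻¹ := by
          rw [eq_inv_iff_mul_eq_one, ← m2]; simp
        rw [this]; exact R.inv_mem (ha u) }
  have hV : (⊤ : Subgroup Q) ≤ V := by
    rw [← hy, Subgroup.closure_le]
    rintro _ ⟨i, rfl⟩ u
    refine ⟨f i u, ⟨Pi.mulSingle i u, ?_⟩, rfl⟩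
    rw [hp, Finset.prod_eq_single i]
    · simp
    · intro j _ hj; simp [Pi.mulSingle_eq_of_ne hj]
    · simp
  have hR : commutator Q ≤ R := by
    rw [commutator_def, Subgroup.commutator_le]
    intro a _ b _
    exact hV (Subgroup.mem_top b) a
  obtain ⟨_, ⟨u, rfl⟩, rfl⟩ := hR hq
  refine ⟨u, ?_⟩
  rw [hp, ← List.prod_ofFn, map_list_prod, List.map_ofFn]
  rfl

theorem metab {r : ℕ} (x : Fin r → G) (hx : Subgroup.closure (Set.range x) = ⊤)
    (hm : ∀ a ∈ commutator G, ∀ b ∈ commutator G, a * b = b * a) :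
    ∃ T : Subgroup G, (∀ c ∈ commutator G, ∀ v : G, ⁅c, v⁆ ∈ T) ∧ T ≤ commutator G ∧
      ∀ t ∈ T, ∃ u : Fin r → G, t = (List.ofFn fun i => ⁅u i, x i⁆).prod := by
  let _ : CommGroup (commutator G) :=
    { (inferInstance : Group (commutator G)) with
      mul_comm := fun a b => Subtype.ext (hm a a.2 b b.2) }
  have hcG : ∀ a b : G, ⁅a, b⁆ ∈ commutator G := fun a b =>
    Subgroup.commutator_mem_commutator (Subgroup.mem_top a) (Subgroup.mem_top b)
  have hn : ∀ c ∈ commutator G, ∀ v : G, v * c * v⁻¹ ∈ commutator G := fun c hc v =>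
    Subgroup.Normal.conj_mem inferInstance c hc v
  let f : Fin r → commutator G →* commutator G := fun i =>
    MonoidHom.mk' (fun u => ⟨⁅(u : G), x i⁆, hcG _ _⟩) (fun a b => Subtype.ext (by
      change ⁅(a : G) * b, x i⁆ = ⁅(a : G), x i⁆ * ⁅(b : G), x i⁆
      have : ⁅(a : G) * b, x i⁆ = a * ⁅(b : G), x i⁆ * (a : G)⁻¹ * ⁅(a : G), x i⁆ := by
        simp only [commutatorElement_def]; group
      rw [this, hm a a.2 _ (hcG b (x i)), mul_inv_cancel_right, hm _ (hcG _ _) _ (hcG _ _)]))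
  let p : (Fin r → commutator G) →* commutator G := ∏ i, (f i).comp (Pi.evalMonoidHom _ i)
  have hp : ∀ u, p u = ∏ i, f i (u i) := by
    intro k; simp [p, MonoidHom.finsetProd_apply]
  let T : Subgroup G := p.range.map (commutator G).subtype
  have hT : T ≤ commutator G := by
    rintro _ ⟨a, _, rfl⟩; exact a.2
  let V : Subgroup G :=
    { carrier := {v | ∀ c ∈ commutator G, ⁅c, v⁆ ∈ T}
      one_mem' := fun u _ => by simp
      mul_mem' := fun {a b} ha hb c hc => by
        have : ⁅c, a * b⁆ = ⁅c, a⁆ * (⁅⁅c, b⁆, a⁆⁻¹ * ⁅c, b⁆) := by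
          simp only [commutatorElement_def]; group
        rw [this]
        exact T.mul_mem (ha c hc) (T.mul_mem (T.inv_mem (ha _ (hcG _ _))) (hb c hc))
      inv_mem' := fun {a} ha c hc => by
        have : ⁅c, a⁻¹⁆ = ⁅a⁻¹ * c * a⁻¹⁻¹, a⁆⁻¹ := by
          simp only [commutatorElement_def]; group
        rw [this]; exact T.inv_mem (ha _ (hn c hc _)) }
  have hV : (⊤ : Subgroup G) ≤ V := by
    rw [← hx, Subgroup.closure_le]
    rintro _ ⟨i, rfl⟩ u hu
    refine ⟨f i ⟨u, hu⟩, ⟨Pi.mulSingle i ⟨u, hu⟩, ?_⟩, rfl⟩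
    rw [hp, Finset.prod_eq_single i]
    · simp
    · intro j _ hj; simp [Pi.mulSingle_eq_of_ne hj]
    · simp
  refine ⟨T, fun c hc v => hV (Subgroup.mem_top v) c hc, hT, ?_⟩
  rintro _ ⟨_, ⟨u, rfl⟩, rfl⟩
  refine ⟨fun i => u i, ?_⟩
  rw [hp, ← List.prod_ofFn, map_list_prod, List.map_ofFn]
  rfl

theorem comm_part {r : ℕ} (x : Fin r → G) (hx : Subgroup.closure (Set.range x) = ⊤)
    (hm : ∀ a ∈ commutator G, ∀ b ∈ commutator G, a * b = b * a) (h : G)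
    (hh : h ∈ commutator G) :
    ∃ u v : Fin r → G, h = (List.ofFn fun i => ⁅u i, x i⁆).prod *
      (List.ofFn fun i => ⁅v i, x i⁆).prod := by
  obtain ⟨T, hT1, hT2, hT3⟩ := metab x hx hm
  have hcG : ∀ a b : G, ⁅a, b⁆ ∈ commutator G := fun a b =>
    Subgroup.commutator_mem_commutator (Subgroup.mem_top a) (Subgroup.mem_top b)
  have : T.Normal := ⟨fun t ht g => by
    have : g * t * g⁻¹ = ⁅t, g⁆⁻¹ * t := by simp only [commutatorElement_def]; group
    rw [this]
    exact T.mul_mem (T.inv_mem (hT1 t (hT2 ht) g)) ht⟩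
  let π := QuotientGroup.mk' T
  have hs : Function.Surjective π := QuotientGroup.mk'_surjective T
  obtain ⟨u, hu⟩ := class_two (fun i => π (x i))
    (by
      have := congrArg (Subgroup.map π) hx
      rw [MonoidHom.map_closure, ← Set.range_comp, Subgroup.map_top_of_surjective _ hs] at this
      exact this)
    (by
      intro a b
      obtain ⟨a, rfl⟩ := hs a
      obtain ⟨b, rfl⟩ := hs b
      rw [Subgroup.mem_center_iff]
      intro c
      obtain ⟨c, rfl⟩ := hs c
      symm
      rw [← commutatorElement_eq_one_iff_mul_comm, ← map_commutatorElement,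
        ← map_commutatorElement]
      exact (QuotientGroup.eq_one_iff _).2 (hT1 _ (hcG a b) c))
    (π h) (by
      have : commutator (G ⧸ T) = (commutator G).map π := by
        rw [commutator_def, commutator_def, Subgroup.map_commutator,
          Subgroup.map_top_of_surjective _ hs]
      rw [this]; exact ⟨h, hh, rfl⟩)
  choose w hw using fun i => hs (u i)
  have ht : (List.ofFn fun i => ⁅w i, x i⁆).prod⁻¹ * h ∈ T := by
    rw [← QuotientGroup.eq_one_iff]
    change π _ = 1
    rw [map_mul, map_inv, hu, map_list_prod, List.map_ofFn]
    have : (π ∘ fun i => ⁅w i, x i⁆) = fun i => ⁅u i, π (x i)⁆ := by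
      funext i; simp only [Function.comp, map_commutatorElement, hw]
    rw [this, inv_mul_cancel]
  obtain ⟨v, hv⟩ := hT3 _ ht
  exact ⟨w, v, by rw [← hv]; group⟩

theorem total {r : ℕ} (x : Fin r → G) (hx : Subgroup.closure (Set.range x) = ⊤)
    (hm : ∀ a ∈ commutator G, ∀ b ∈ commutator G, a * b = b * a) (g : G) :
    IsProdOfPalindromes (Set.range x) (r * 1 + (r * 3 + r * 3)) g := by
  obtain ⟨k, h, hh, rfl⟩ := abel_part x hx g
  obtain ⟨u, v, rfl⟩ := comm_part x hx hm h hh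
  exact prod_mul (prod_ofFn fun i => pal_zpow (Set.mem_range_self i) _)
    (prod_mul (prod_ofFn fun i => pal_comm hx (Set.mem_range_self i) _)
      (prod_ofFn fun i => pal_comm hx (Set.mem_range_self i) _))

end PalW

theorem free_metabelian_palindromic_width (r : ℕ) (hr : 1 ≤ r) :
    ∀ g : FreeMetabelian r,
      IsProdOfPalindromes
        {x : FreeMetabelian r | ∃ i : Fin r, x = QuotientGroup.mk (FreeGroup.of i)}
        (2 ^ (r - 1) * r * (r + 1) * (2 * r + 3) + 4 * r + 1) g := by
  intro g
  let π := QuotientGroup.mk' (secondDerived (FreeGroup (Fin r)))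
  have hs : Function.Surjective π := QuotientGroup.mk'_surjective _
  let x : Fin r → FreeMetabelian r := fun i => π (FreeGroup.of i)
  have hx : Subgroup.closure (Set.range x) = ⊤ := by
    have := congrArg (Subgroup.map π) (FreeGroup.closure_range_of (Fin r))
    rw [MonoidHom.map_closure, ← Set.range_comp, Subgroup.map_top_of_surjective _ hs] at this
    exact this
  have hc : commutator (FreeMetabelian r) = (commutator (FreeGroup (Fin r))).map π := by
    rw [commutator_def, commutator_def, Subgroup.map_commutator,
      Subgroup.map_top_of_surjective _ hs]
  have hm : ∀ a ∈ commutator (FreeMetabelian r), ∀ b ∈ commutator (FreeMetabelian r),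
      a * b = b * a := by
    rw [hc]
    rintro _ ⟨a, ha, rfl⟩ _ ⟨b, hb, rfl⟩
    rw [← commutatorElement_eq_one_iff_mul_comm, ← map_commutatorElement]
    exact (QuotientGroup.eq_one_iff _).2 (Subgroup.commutator_mem_commutator ha hb)
  have hset : {x : FreeMetabelian r | ∃ i : Fin r, x = QuotientGroup.mk (FreeGroup.of i)}
      = Set.range x := by
    ext y
    exact ⟨fun ⟨i, hi⟩ => ⟨i, hi.symm⟩, fun ⟨i, hi⟩ => ⟨i, hi.symm⟩⟩
  rw [hset]
  refine PalW.prod_mono (PalW.total x hx hm g) ?_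
  have h1 : 1 ≤ 2 ^ (r - 1) := Nat.one_le_two_pow
  have h2 : 1 * r * (1 + 1) * (2 * 1 + 3) ≤ 2 ^ (r - 1) * r * (r + 1) * (2 * r + 3) := by
    gcongr
  omega
end

section
/- Let r ≥ 1, let F be the free group on r generators x₁,…,x_r, F' its derived subgroup, F'' its second derived subgroup, and M_r = F/F'' the free metabelian group of rank r with generators x̄₁,…,x̄_r (the images of the free generators). If ℓ ∈ ℕ is such that every element of the image of F' in M_r is a product of ℓ palindromes over {x̄₁,…,x̄_r}, then every element of M_r is a product of ℓ + r palindromes over {x̄₁,…,x̄_r}. -/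
theorem exists_exponents (r : ℕ) (f : FreeGroup (Fin r)) :
    ∃ e : Fin r → ℤ, Abelianization.of f =
      ∏ i, Abelianization.of (FreeGroup.of i) ^ e i := by
  induction f using FreeGroup.induction_on with
  | C1 => exact ⟨0, by simp⟩
  | of i =>
    refine ⟨Pi.single i 1, ?_⟩
    rw [Finset.prod_eq_single i]
    · simp
    · intro b _ hb
      simp [Pi.single_eq_of_ne hb]
    · simp
  | inv_of i ih =>
    obtain ⟨e, he⟩ := ih
    exact ⟨-e, by rw [map_inv, he]; simp⟩
  | mul x y hx hy =>
    obtain ⟨e, he⟩ := hx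
    obtain ⟨e', he'⟩ := hy
    exact ⟨e + e', by rw [map_mul, he, he']; simp [zpow_add, Finset.prod_mul_distrib]⟩

theorem zpow_palindrome {G : Type*} [Group G] (X : Set G) (x : G) (hx : x ∈ X) (n : ℤ) :
    ∃ w : List G, IsPalindromicWord X w ∧ w.prod = x ^ n := by
  obtain ⟨m, rfl | rfl⟩ := n.eq_nat_or_neg
  · refine ⟨List.replicate m x, ⟨?_, by simp⟩, by simp⟩
    intro g hg
    rw [List.eq_of_mem_replicate hg]
    exact Or.inl hx
  · refine ⟨List.replicate m x⁻¹, ⟨?_, by simp⟩, by simp⟩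
    intro g hg
    rw [List.eq_of_mem_replicate hg]
    right
    simpa using hx

theorem free_metabelian_reduce_to_derived (r : ℕ) (hr : 1 ≤ r) (ℓ : ℕ)
    (h : ∀ g ∈ (commutator (FreeGroup (Fin r))).map
        (QuotientGroup.mk' (secondDerived (FreeGroup (Fin r)))),
      IsProdOfPalindromes
        {x : FreeMetabelian r | ∃ i : Fin r, x = QuotientGroup.mk (FreeGroup.of i)} ℓ g) :
    ∀ g : FreeMetabelian r,
      IsProdOfPalindromes
        {x : FreeMetabelian r | ∃ i : Fin r, x = QuotientGroup.mk (FreeGroup.of i)}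
        (ℓ + r) g := by
  intro g
  obtain ⟨f, rfl⟩ := QuotientGroup.mk'_surjective _ g
  obtain ⟨e, he⟩ := exists_exponents r f
  set p : FreeGroup (Fin r) := (List.ofFn fun i => FreeGroup.of i ^ e i).prod with hp
  have hc : f * p⁻¹ ∈ commutator (FreeGroup (Fin r)) := by
    rw [← Abelianization.ker_of, MonoidHom.mem_ker, map_mul, map_inv, he, mul_inv_eq_one, hp,
      map_list_prod, List.map_ofFn, List.prod_ofFn]
    simp
  obtain ⟨ws, hl, hw, hprod⟩ := h _ (Subgroup.mem_map_of_mem _ hc)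
  choose v hv hvp using fun i : Fin r => zpow_palindrome
    {x : FreeMetabelian r | ∃ i : Fin r, x = QuotientGroup.mk (FreeGroup.of i)}
    (QuotientGroup.mk' (secondDerived (FreeGroup (Fin r))) (FreeGroup.of i)) ⟨i, rfl⟩ (e i)
  refine ⟨ws ++ List.ofFn v, by simp [hl], ?_, ?_⟩
  · intro w hmem
    rcases List.mem_append.1 hmem with hmem | hmem
    · exact hw w hmem
    · obtain ⟨i, rfl⟩ := (List.mem_ofFn' _ _).1 hmem
      exact hv i
  · have h2 : ((List.ofFn v).map List.prod).prod =
        QuotientGroup.mk' (secondDerived (FreeGroup (Fin r))) p := by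
      rw [hp, map_list_prod, List.map_ofFn, List.map_ofFn]
      congr 2
      funext i
      simp only [Function.comp, hvp, map_zpow]
    rw [List.map_append, List.prod_append, hprod, h2, ← map_mul, inv_mul_cancel_right]
end
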